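/- For each i ∈ {1,…,n+1} one has ⟨1|u_i⟩ ≠ 0; in particular all the quadrature weights w_i = ⟨1|u_i⟩² are strictly positive. -/

import Mathlib

open Polynomial MeasureTheory

/-- Integration of polynomials against a weight continuous on `[a, b]`, as a linear functional. -/
noncomputable def weightedIntegral (a b : ℝ) (hab : a ≤ b) (w : ℝ → ℝ)
    (hw : ContinuousOn w (Set.Icc a b)) : ℝ[X] →ₗ[ℝ] ℝ where
  toFun p := ∫ t in a..b, w t * p.eval t
  map_add' p q := by
    have hint (r : ℝ[X]) : IntervalIntegrable (fun t => w t * r.eval t) volume a b :=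
      ContinuousOn.intervalIntegrable_of_Icc hab (hw.mul r.continuousOn)
    simp only [eval_add, mul_add]
    exact intervalIntegral.integral_add (hint p) (hint q)
  map_smul' c p := by
    simp only [eval_smul, smul_eq_mul, RingHom.id_apply, mul_left_comm (w _) c]
    exact intervalIntegral.integral_const_mul c _

section Orthonormal

variable {n : ℕ} {L : ℝ[X] →ₗ[ℝ] ℝ} {u : Fin (n + 1) → ℝ[X]}

lemma linearIndependent_of_orthonormal_functional
    (horth : ∀ i j, L (u i * u j) = if i = j then 1 else 0) : LinearIndependent ℝ u := by
  rw [Fintype.linearIndependent_iff]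
  intro g hg j
  simpa [Finset.mul_sum, horth] using congrArg (fun p => L (u j * p)) hg

lemma span_range_eq_degreeLT_of_orthonormal_functional (hdeg : ∀ i, (u i).natDegree ≤ n)
    (horth : ∀ i j, L (u i * u j) = if i = j then 1 else 0) :
    Submodule.span ℝ (Set.range u) = degreeLT ℝ (n + 1) := by
  have : Module.Finite ℝ (degreeLT ℝ (n + 1)) :=
    Module.Finite.equiv (degreeLTEquiv ℝ (n + 1)).symm
  apply Submodule.eq_of_le_of_finrank_le
  · rw [Submodule.span_le]
    rintro _ ⟨i, rfl⟩
    exact mem_degreeLT.2 (degree_le_natDegree.trans_lt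
      (Nat.cast_lt.2 (Nat.lt_succ_of_le (hdeg i))))
  · rw [finrank_span_eq_card (linearIndependent_of_orthonormal_functional horth),
      (degreeLTEquiv ℝ (n + 1)).finrank_eq]
    simp

/-- If `u` is an orthonormal family of `n + 1` polynomials of degree at most `n` which also
diagonalizes multiplication by `X`, then no `u i` is orthogonal to the constants. -/
lemma functional_ne_zero_of_orthonormal_of_diagonal (hdeg : ∀ i, (u i).natDegree ≤ n)
    (horth : ∀ i j, L (u i * u j) = if i = j then 1 else 0) {x : Fin (n + 1) → ℝ}
    (hdiag : ∀ i j, L (X * u i * u j) = if i = j then x i else 0) (i : Fin (n + 1)) :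
    L (u i) ≠ 0 := by
  intro hzero
  have hkernel (p : ℝ[X]) (hp : p ∈ degreeLT ℝ (n + 1)) : L ((X - C (x i)) * u i * p) = 0 := by
    rw [← span_range_eq_degreeLT_of_orthonormal_functional hdeg horth] at hp
    induction hp using Submodule.span_induction with
    | mem p hp =>
      obtain ⟨j, rfl⟩ := hp
      rw [sub_mul, sub_mul, map_sub, hdiag, mul_assoc, ← smul_eq_C_mul, map_smul, horth]
      simp
    | zero => simp
    | add p q _ _ hp hq => rw [mul_add, map_add, hp, hq, add_zero]
    | smul c p _ hp => rw [mul_smul_comm, map_smul, hp, smul_zero]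
  have hdiv : u i = (X - C (x i)) * (u i /ₘ (X - C (x i))) + C ((u i).eval (x i)) := by
    rw [← modByMonic_X_sub_C_eq_C_eval, add_comm, modByMonic_add_div]
  have hq : u i /ₘ (X - C (x i)) ∈ degreeLT ℝ (n + 1) :=
    mem_degreeLT.2 (degree_le_natDegree.trans_lt (Nat.cast_lt.2 (by
      rw [natDegree_divByMonic _ (monic_X_sub_C _)]
      have := hdeg i
      omega)))
  have hone : L (u i * u i) = 0 := calc
    L (u i * u i) = L ((X - C (x i)) * u i * (u i /ₘ (X - C (x i))) +
        (u i).eval (x i) • u i) := by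
      congr 1
      nth_rewrite 2 [hdiv]
      rw [smul_eq_C_mul]
      ring
    _ = 0 := by rw [map_add, hkernel _ hq, map_smul, hzero, smul_zero, add_zero]
  simp [horth] at hone

end Orthonormal

/-- For each `i`, `⟨1|u_i⟩ ≠ 0`; in particular all the quadrature weights
`w_i = ⟨1|u_i⟩²` are strictly positive. -/
theorem weights_pos
(n : ℕ) (a b : ℝ) (hab : a < b)
    (w : ℝ → ℝ) (hw_cont : ContinuousOn w (Set.Icc a b))
    (hw_pos : ∀ t ∈ Set.Ioo a b, 0 < w t)
    (u : Fin (n + 1) → Polynomial ℝ) (hu_deg : ∀ i, (u i).natDegree ≤ n)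
    (x : Fin (n + 1) → ℝ)
    (horth : ∀ i j, (∫ t in a..b, w t * (u i).eval t * (u j).eval t)
      = if i = j then 1 else 0)
    (heig : ∀ i j, (∫ t in a..b, w t * t * (u i).eval t * (u j).eval t)
      = if i = j then x i else 0)
    (i : Fin (n + 1)) :
    (∫ t in a..b, w t * (u i).eval t) ≠ 0 ∧
      0 < (∫ t in a..b, w t * (u i).eval t) ^ 2 := by
  have hne : weightedIntegral a b hab.le w hw_cont (u i) ≠ 0 := by
    refine functional_ne_zero_of_orthonormal_of_diagonal (x := x) hu_deg
      (fun i j => ?_) (fun i j => ?_) i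
    · simpa [weightedIntegral, mul_assoc] using horth i j
    · simpa [weightedIntegral, mul_assoc] using heig i j
  exact ⟨hne, sq_pos_of_ne_zero hne⟩
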